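/- arXiv:1908.09143 — 3 statements merged into one kernel-verified Lean document; each statement's English description precedes it below -/
import Mathlib

section
/- Let u : ℝ → ℝ be twice continuously differentiable with u, u′ and u″ bounded, and suppose moreover that u′ is Lebesgue integrable on ℝ. Then for every x ∈ ℝ the two principal-value limits lim_{ε→0⁺} ∫_{|y|>ε} (u(x)−u(x+y))/|y|² dy and lim_{ε→0⁺} ∫_{|x−y|>ε} u′(y)/(x−y) dy exist and satisfy (1/π)·lim_{ε→0⁺} ∫_{|y|>ε} (u(x)−u(x+y))/|y|² dy = (1/π)·lim_{ε→0⁺} ∫_{|x−y|>ε} u′(y)/(x−y) dy; that is, the half-Laplacian of u equals the Hilbert transform of u′. -/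
open MeasureTheory Filter Set Real

/-- Folding an integral over the complement of a symmetric interval onto the half-line. -/
lemma setIntegral_lt_abs_eq_integral_Ioi {f : ℝ → ℝ} {ε : ℝ} (hε : 0 < ε)
    (hpos : IntegrableOn f (Ioi ε)) (hneg : IntegrableOn (fun y => f (-y)) (Ioi ε)) :
    ∫ y in {y : ℝ | ε < |y|}, f y = ∫ y in Ioi ε, (f y + f (-y)) := by
  have hset : {y : ℝ | ε < |y|} = Ioi ε ∪ Iio (-ε) := by
    ext y
    simp only [mem_ofPred_eq, mem_union, mem_Ioi, mem_Iio, lt_abs, lt_neg]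
  have hdisj : Disjoint (Ioi ε) (Iio (-ε)) := by
    rw [Set.disjoint_left]
    intro y hy hy'
    simp only [mem_Ioi, mem_Iio] at hy hy'
    linarith
  have hneg' : IntegrableOn f (Iio (-ε)) := by
    simpa only [neg_neg] using
      IntegrableOn.comp_neg_Iio (c := -ε) (f := fun y => f (-y)) (by rwa [neg_neg])
  rw [hset, setIntegral_union hdisj measurableSet_Iio hpos hneg', integral_add hpos hneg,
    integral_comp_neg_Ioi, integral_Iic_eq_integral_Iio]

/-- A bounded continuous function divided by the square is integrable away from the origin. -/
lemma integrableOn_Ioi_div_sq {g : ℝ → ℝ} (hg : Continuous g) {M : ℝ} (hM : ∀ y, |g y| ≤ M)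
    {ε : ℝ} (hε : 0 < ε) : IntegrableOn (fun y => g y / y ^ 2) (Ioi ε) := by
  have hbase : IntegrableOn (fun y : ℝ => M * y ^ (-2 : ℝ)) (Ioi ε) :=
    (integrableOn_Ioi_rpow_of_lt (by norm_num) hε).const_mul M
  refine Integrable.mono' hbase
    (hg.measurable.div (measurable_id.pow_const 2)).aestronglyMeasurable ?_
  filter_upwards [ae_restrict_mem measurableSet_Ioi] with y hy
  have hy0 : 0 < y := hε.trans hy
  rw [Real.norm_eq_abs, abs_div, abs_of_pos (pow_pos hy0 2), Real.rpow_neg hy0.le,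
    Real.rpow_two, ← div_eq_mul_inv]
  gcongr
  exact hM y

/-- An integrable function divided by the variable is integrable away from the origin. -/
lemma integrableOn_Ioi_div {h : ℝ → ℝ} (hh : Integrable h) {ε : ℝ} (hε : 0 < ε) :
    IntegrableOn (fun y => h y / y) (Ioi ε) := by
  refine Integrable.mono' (hh.norm.div_const ε).integrableOn
    (hh.aemeasurable.restrict.div aemeasurable_id).aestronglyMeasurable ?_
  filter_upwards [ae_restrict_mem measurableSet_Ioi] with y hy
  have hy0 : 0 < y := hε.trans hy
  rw [norm_div, Real.norm_of_nonneg hy0.le]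
  gcongr
  exact (show ε < y from hy).le

/-- An integrable function that is `O(y)` at the origin stays integrable on the half-line after
division by the variable. -/
lemma integrableOn_Ioi_zero_div {h : ℝ → ℝ} (hh : Integrable h) {C : ℝ}
    (hC : ∀ y, 0 < y → |h y| ≤ C * y) : IntegrableOn (fun y => h y / y) (Ioi 0) := by
  rw [← Ioc_union_Ioi_eq_Ioi (zero_le_one (α := ℝ))]
  refine IntegrableOn.union ?_ (integrableOn_Ioi_div hh one_pos)
  refine Integrable.mono' (integrableOn_const (C := C) (by simp))
    (hh.aemeasurable.restrict.div aemeasurable_id).aestronglyMeasurable ?_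
  filter_upwards [ae_restrict_mem measurableSet_Ioc] with y hy
  rw [Real.norm_eq_abs, abs_div, abs_of_pos hy.1, div_le_iff₀ hy.1]
  exact hC y hy.1

/-- Integrals over `(ε, ∞)` converge to the integral over `(0, ∞)` as `ε → 0⁺`. -/
lemma tendsto_integral_Ioi_nhdsGT_zero {f : ℝ → ℝ} (hf : IntegrableOn f (Ioi 0)) :
    Tendsto (fun ε : ℝ => ∫ y in Ioi ε, f y) (nhdsWithin 0 (Ioi 0))
      (nhds (∫ y in Ioi 0, f y)) := by
  have hcover : AECover (volume.restrict (Ioi (0 : ℝ))) (nhdsWithin 0 (Ioi 0))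
      (fun ε : ℝ => Ioi ε) := aecover_Ioi_of_Ioi nhdsWithin_le_nhds
  refine (hcover.integral_tendsto_of_countably_generated hf).congr' ?_
  filter_upwards [self_mem_nhdsWithin] with ε hε
  rw [Measure.restrict_restrict measurableSet_Ioi,
    inter_eq_left.mpr (Ioi_subset_Ioi (show (0 : ℝ) < ε from hε).le)]

/-- Integration by parts for `g / y²` on `(ε, ∞)`. -/
lemma integral_Ioi_div_sq {g g' : ℝ → ℝ} (hg : ∀ y, HasDerivAt g (g' y) y) {M : ℝ}
    (hM : ∀ y, |g y| ≤ M) (hg' : Integrable g') {ε : ℝ} (hε : 0 < ε) :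
    ∫ y in Ioi ε, g y / y ^ 2 = g ε / ε + ∫ y in Ioi ε, g' y / y := by
  have hcont : Continuous g := continuous_iff_continuousAt.mpr fun y => (hg y).continuousAt
  have hsq := integrableOn_Ioi_div_sq hcont hM hε
  have hdiv := integrableOn_Ioi_div hg' hε
  have hderiv : ∀ y ∈ Ici ε, HasDerivAt (fun y => -(g y / y)) (g y / y ^ 2 - g' y / y) y := by
    intro y hy
    have hy0 : y ≠ 0 := (hε.trans_le hy).ne'
    convert! ((hg y).div (hasDerivAt_id y) hy0).neg using 1
    simp only [id]
    field_simp
    ring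
  have hlim : Tendsto (fun y => -(g y / y)) atTop (nhds 0) := by
    refine squeeze_zero_norm' ?_ ((tendsto_const_nhds (x := M)).div_atTop tendsto_id)
    filter_upwards [eventually_gt_atTop 0] with y hy
    rw [norm_neg, norm_div, Real.norm_of_nonneg hy.le]
    exact div_le_div_of_nonneg_right (hM y) hy.le
  have hFTC := integral_Ioi_of_hasDerivAt_of_tendsto' hderiv (hsq.sub hdiv) hlim
  rw [integral_sub hsq hdiv] at hFTC
  linarith

/-- Case α = 1 of Lemma 1: the half-Laplacian equals the Hilbert transform of u′. -/
theorem stmt_1 (u : ℝ → ℝ) (hu : ContDiff ℝ 2 u)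
    (hub : ∃ M, ∀ y, |u y| ≤ M)
    (hub' : ∃ M, ∀ y, |deriv u y| ≤ M)
    (hub'' : ∃ M, ∀ y, |deriv (deriv u) y| ≤ M)
    (hint : Integrable (deriv u))
    (x : ℝ) :
    ∃ A B : ℝ,
      Tendsto (fun ε : ℝ => ∫ y in {y : ℝ | ε < |y|}, (u x - u (x + y)) / |y| ^ 2)
        (nhdsWithin 0 (Set.Ioi 0)) (nhds A) ∧
      Tendsto (fun ε : ℝ => ∫ y in {y : ℝ | ε < |x - y|}, deriv u y / (x - y))
        (nhdsWithin 0 (Set.Ioi 0)) (nhds B) ∧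
      (1 / π) * A = (1 / π) * B := by
  obtain ⟨M, hM⟩ := hub
  obtain ⟨C, hC⟩ := hub''
  have hdu : Differentiable ℝ u := hu.differentiable (by norm_num)
  have hddu : Differentiable ℝ (deriv u) :=
    (ContDiff.deriv' (n := 1) (by simpa [one_add_one_eq_two] using hu)).differentiable
      (by norm_num)
  set g : ℝ → ℝ := fun y => (u x - u (x + y)) + (u x - u (x - y)) with hgdef
  set g' : ℝ → ℝ := fun y => deriv u (x - y) - deriv u (x + y) with hg'def
  have hderiv : ∀ y, HasDerivAt g (g' y) y := by
    intro y
    have h₁ := (hdu (x + y)).hasDerivAt.comp_const_add x y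
    have h₂ := (hdu (x - y)).hasDerivAt.comp_const_sub x y
    convert! (h₁.const_sub (u x)).add (h₂.const_sub (u x)) using 1
    simp only [hg'def]
    ring
  have hbound : ∀ z, |u x - u z| ≤ 2 * M := fun z => by
    linarith [abs_sub (u x) (u z), hM x, hM z]
  have hgM : ∀ y, |g y| ≤ 4 * M := fun y => by
    linarith [abs_add_le (u x - u (x + y)) (u x - u (x - y)), hbound (x + y), hbound (x - y)]
  have hint_add : Integrable (fun y => deriv u (x + y)) := hint.comp_add_left x
  have hint_sub : Integrable (fun y => deriv u (x - y)) := hint.comp_sub_left x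
  have hg'int : Integrable g' := hint_sub.sub hint_add
  have hg'C : ∀ y, 0 < y → |g' y| ≤ 2 * C * y := by
    intro y hy
    have hlip := convex_univ.norm_image_sub_le_of_norm_deriv_le (f := deriv u) (C := C)
      (fun z _ => hddu z) (fun z _ => hC z) (mem_univ (x + y)) (mem_univ (x - y))
    have hdist : ‖x - y - (x + y)‖ = 2 * y := by
      rw [Real.norm_eq_abs, show x - y - (x + y) = -(2 * y) by ring, abs_neg,
        abs_of_pos (by linarith)]
    rw [hdist, Real.norm_eq_abs] at hlip
    linarith
  have hlim := tendsto_integral_Ioi_nhdsGT_zero (integrableOn_Ioi_zero_div hg'int hg'C)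
  have hg0 : g 0 = 0 := by simp [hgdef]
  have hg'0 : g' 0 = 0 := by simp [hg'def]
  have hbdry : Tendsto (fun ε => g ε / ε) (nhdsWithin 0 (Ioi 0)) (nhds 0) := by
    have hslope := (hderiv 0).tendsto_slope_zero_right
    simpa [hg0, hg'0, div_eq_inv_mul] using hslope
  refine ⟨∫ y in Ioi 0, g' y / y, ∫ y in Ioi 0, g' y / y, ?_, ?_, rfl⟩
  · have hsum := hbdry.add hlim
    rw [zero_add] at hsum
    refine hsum.congr' ?_
    filter_upwards [self_mem_nhdsWithin] with ε hε
    rw [← integral_Ioi_div_sq hderiv hgM hg'int hε]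
    simp only [sq_abs]
    have hcont := hdu.continuous
    rw [setIntegral_lt_abs_eq_integral_Ioi hε
      (integrableOn_Ioi_div_sq (by fun_prop) (fun y => hbound (x + y)) hε)]
    · simp only [hgdef, neg_sq, ← sub_eq_add_neg, add_div]
    · simpa only [neg_sq] using
        integrableOn_Ioi_div_sq (by fun_prop) (fun y => hbound (x + -y)) hε
  · refine hlim.congr' ?_
    filter_upwards [self_mem_nhdsWithin] with ε hε
    have hmeas : ∀ φ : ℝ → ℝ, Continuous φ → MeasurableSet {y : ℝ | ε < |φ y|} := fun φ hφ =>
      (isOpen_lt continuous_const hφ.abs).measurableSet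
    have hchange : ∫ y in {y : ℝ | ε < |x - y|}, deriv u y / (x - y)
        = ∫ y in {y : ℝ | ε < |y|}, deriv u (x - y) / y := by
      rw [← integral_indicator (hmeas (fun y => x - y) (by fun_prop)),
        ← integral_indicator (hmeas (fun y => y) continuous_id),
        ← integral_sub_left_eq_self _ volume x]
      refine integral_congr_ae (ae_of_all _ fun y => ?_)
      simp [indicator]
    rw [hchange, setIntegral_lt_abs_eq_integral_Ioi hε (integrableOn_Ioi_div hint_sub hε)]
    · simp only [hg'def, sub_neg_eq_add, div_neg, sub_div, ← sub_eq_add_neg]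
    · simpa only [sub_neg_eq_add, div_neg, Pi.neg_def] using (integrableOn_Ioi_div hint_add hε).neg
end

section
/- Let k be an odd integer and s ∈ (0,π). Then sin(s) · lim_{ε→0⁺} ∫_{{η ∈ (0,π) : |η−s| > ε}} sin(η)·e^{ikη}/sin(s−η) dη = −2/(k²−4) − Σ_{l ∈ ℤ, l ≠ 0} 4·sgn(l)·e^{2ils}/((k−2l)·((k−2l)²−4)), where the series over the nonzero integers l converges absolutely. -/
open MeasureTheory Filter Set Real

theorem sin_sub_ne_zero {s ε η : ℝ} (hs : s ∈ Set.Ioo 0 π) (hε : 0 < ε)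
    (hη : η ∈ Icc 0 π ∩ {η : ℝ | ε ≤ |η - s|}) : Real.sin (s - η) ≠ 0 := by
  obtain ⟨⟨h0, hπ⟩, hη : ε ≤ |η - s|⟩ := hη
  obtain ⟨hs0, hsπ⟩ := hs
  intro h
  have := (Real.sin_eq_zero_iff_of_lt_of_lt (by linarith) (by linarith)).1 h
  rw [show η - s = 0 by linarith, abs_zero] at hη
  linarith

theorem truncated_subset (s ε : ℝ) :
    {η : ℝ | η ∈ Set.Ioo 0 π ∧ ε < |η - s|} ⊆ Icc 0 π ∩ {η : ℝ | ε ≤ |η - s|} :=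
  fun _ hη => ⟨Ioo_subset_Icc_self hη.1, hη.2.le⟩

theorem integrableOn_div_sin_sub (s : ℝ) (hs : s ∈ Set.Ioo 0 π) {f : ℝ → ℂ} (hf : Continuous f)
    {ε : ℝ} (hε : 0 < ε) :
    IntegrableOn (fun η => f η / (Real.sin (s - η) : ℂ))
      {η : ℝ | η ∈ Set.Ioo 0 π ∧ ε < |η - s|} := by
  have hK : IsCompact (Icc 0 π ∩ {η : ℝ | ε ≤ |η - s|}) :=
    isCompact_Icc.inter_right (isClosed_le continuous_const (by fun_prop))
  refine (ContinuousOn.integrableOn_compact hK ?_).mono_set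
    (truncated_subset s ε)
  refine hf.continuousOn.div (by fun_prop) fun η hη => ?_
  rw [Complex.ofReal_ne_zero]
  exact sin_sub_ne_zero hs hε hη

theorem setIntegral_truncated_eq {s ε : ℝ} (hε : 0 < ε) (h0 : ε < s) (hπ : ε < π - s) {f : ℝ → ℂ}
    (hf : IntegrableOn f {η : ℝ | η ∈ Set.Ioo 0 π ∧ ε < |η - s|}) :
    ∫ η in {η : ℝ | η ∈ Set.Ioo 0 π ∧ ε < |η - s|}, f η
      = (∫ η in 0..(s - ε), f η) + ∫ η in (s + ε)..π, f η := by
  have key : {η : ℝ | η ∈ Set.Ioo 0 π ∧ ε < |η - s|} = Ioo 0 (s - ε) ∪ Ioo (s + ε) π := by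
    ext η
    simp only [mem_ofPred_eq, mem_Ioo, mem_union, lt_abs]
    constructor
    · rintro ⟨⟨h1, h2⟩, h | h⟩
      · exact .inr ⟨by linarith, h2⟩
      · exact .inl ⟨h1, by linarith⟩
    · rintro (⟨h1, h2⟩ | ⟨h1, h2⟩)
      · exact ⟨⟨h1, by linarith⟩, .inr (by linarith)⟩
      · exact ⟨⟨by linarith, h2⟩, .inl (by linarith)⟩
  rw [key] at hf ⊢
  rw [setIntegral_union _ measurableSet_Ioo hf.left_of_union hf.right_of_union,
    intervalIntegral.integral_of_le (by linarith), intervalIntegral.integral_of_le (by linarith),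
    integral_Ioc_eq_integral_Ioo, integral_Ioc_eq_integral_Ioo]
  exact Set.disjoint_left.2 fun η h1 h2 => by
    have := h1.2; have := h2.1; linarith

theorem eventually_truncation_small {s : ℝ} (hs : s ∈ Set.Ioo 0 π) :
    ∀ᶠ ε in nhdsWithin (0 : ℝ) (Ioi 0), 0 < ε ∧ ε < s ∧ ε < π - s := by
  filter_upwards [self_mem_nhdsWithin,
    mem_nhdsWithin_of_mem_nhds (Iio_mem_nhds hs.1),
    mem_nhdsWithin_of_mem_nhds (Iio_mem_nhds (sub_pos.2 hs.2))] with ε h1 h2 h3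
  exact ⟨h1, h2, h3⟩

theorem integrableOn_truncated {s ε : ℝ} {f : ℝ → ℂ} (hf : Continuous f) :
    IntegrableOn f {η : ℝ | η ∈ Set.Ioo 0 π ∧ ε < |η - s|} :=
  (hf.integrableOn_Icc (a := 0) (b := π)).mono_set fun _ hη => Ioo_subset_Icc_self hη.1

theorem tendsto_setIntegral_truncated {s : ℝ} (hs : s ∈ Set.Ioo 0 π) {f : ℝ → ℂ}
    (hf : Continuous f) :
    Tendsto (fun ε : ℝ => ∫ η in {η : ℝ | η ∈ Set.Ioo 0 π ∧ ε < |η - s|}, f η)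
      (nhdsWithin 0 (Set.Ioi 0)) (nhds (∫ η in 0..π, f η)) := by
  have hc : Continuous fun ε : ℝ => (∫ η in 0..(s - ε), f η) + ∫ η in (s + ε)..π, f η := by
    have hp : Continuous fun b : ℝ => ∫ η in 0..b, f η :=
      intervalIntegral.continuous_primitive (fun a b => hf.intervalIntegrable a b) 0
    have : (fun ε : ℝ => (∫ η in 0..(s - ε), f η) + ∫ η in (s + ε)..π, f η) = fun ε : ℝ =>
        (∫ η in 0..(s - ε), f η) + ((∫ η in 0..π, f η) - ∫ η in 0..(s + ε), f η) := by
      funext ε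
      rw [intervalIntegral.integral_interval_sub_left (hf.intervalIntegrable _ _)
        (hf.intervalIntegrable _ _)]
    rw [this]
    exact (hp.comp (by fun_prop)).add (continuous_const.sub (hp.comp (by fun_prop)))
  have h := (hc.tendsto 0).mono_left (nhdsWithin_le_nhds (s := Ioi 0))
  simp only [sub_zero, add_zero] at h
  rw [intervalIntegral.integral_add_adjacent_intervals (hf.intervalIntegrable _ _)
    (hf.intervalIntegrable _ _)] at h
  refine h.congr' ?_
  filter_upwards [eventually_truncation_small hs] with ε ⟨h1, h2, h3⟩
  exact (setIntegral_truncated_eq h1 h2 h3 (integrableOn_truncated hf)).symm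

theorem integral_inv_sin_sub {s a b : ℝ} (hne : ∀ η ∈ uIcc a b, Real.sin (s - η) ≠ 0) :
    ∫ η in a..b, (1 / (Real.sin (s - η) : ℂ))
      = ((Real.log (Real.tan ((s - a) / 2)) - Real.log (Real.tan ((s - b) / 2)) : ℝ) : ℂ) := by
  have h1 : ∫ η in a..b, (1 / Real.sin (s - η))
      = Real.log (Real.tan ((s - a) / 2)) - Real.log (Real.tan ((s - b) / 2)) := by
    have hd : ∀ η ∈ uIcc a b, HasDerivAt (fun η => -Real.log (Real.tan ((s - η) / 2)))
        (1 / Real.sin (s - η)) η := by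
      intro η hη
      have h2 : Real.sin (s - η) = 2 * Real.sin ((s - η) / 2) * Real.cos ((s - η) / 2) := by
        rw [← Real.sin_two_mul]; congr 1; ring
      have h3 := hne η hη
      rw [h2] at h3
      have hsn : Real.sin ((s - η) / 2) ≠ 0 := fun h => h3 (by rw [h]; ring)
      have hcs : Real.cos ((s - η) / 2) ≠ 0 := fun h => h3 (by rw [h]; ring)
      have ht : Real.tan ((s - η) / 2) ≠ 0 := by
        rw [Real.tan_eq_sin_div_cos]; exact div_ne_zero hsn hcs
      have hi : HasDerivAt (fun η : ℝ => (s - η) / 2) (-1 / 2) η :=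
        ((hasDerivAt_id η).const_sub s).div_const 2
      have := (((Real.hasDerivAt_tan hcs).comp η hi).log (by simpa using ht)).neg
      refine this.congr_deriv ?_
      simp only [Function.comp]
      rw [h2, Real.tan_eq_sin_div_cos]
      field_simp
    rw [intervalIntegral.integral_eq_sub_of_hasDerivAt hd]
    · ring
    · exact ContinuousOn.intervalIntegrable
        (continuousOn_const.div (by fun_prop) hne)
  rw [← h1, ← intervalIntegral.integral_ofReal]
  simp

theorem tendsto_inv_sin {s : ℝ} (hs : s ∈ Set.Ioo 0 π) :
    Tendsto (fun ε : ℝ => ∫ η in {η : ℝ | η ∈ Set.Ioo 0 π ∧ ε < |η - s|},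
        (1 / (Real.sin (s - η) : ℂ)))
      (nhdsWithin 0 (Set.Ioi 0)) (nhds ((2 * Real.log (Real.tan (s / 2)) : ℝ) : ℂ)) := by
  refine tendsto_const_nhds.congr' ?_
  filter_upwards [eventually_truncation_small hs] with ε ⟨h1, h2, h3⟩
  rw [setIntegral_truncated_eq h1 h2 h3 (integrableOn_div_sin_sub s hs continuous_const h1),
    integral_inv_sin_sub, integral_inv_sin_sub, ← Complex.ofReal_add]
  · congr 1
    rw [show (s - (s + ε)) / 2 = -(ε / 2) by ring, show (s - (s - ε)) / 2 = ε / 2 by ring,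
      show (s - π) / 2 = -(π / 2 - s / 2) by ring, Real.tan_neg, Real.tan_neg,
      Real.log_neg_eq_log, Real.log_neg_eq_log, Real.tan_pi_div_two_sub, Real.log_inv, sub_zero]
    ring
  · intro η hη
    rw [uIcc_of_le (by linarith)] at hη
    obtain ⟨hη1, hη2⟩ := hη
    refine (Real.sin_neg_of_neg_of_neg_pi_lt (by linarith) (by linarith [hs.1])).ne
  · intro η hη
    rw [uIcc_of_le (by linarith)] at hη
    obtain ⟨hη1, hη2⟩ := hη
    exact (Real.sin_pos_of_pos_of_lt_pi (by linarith) (by linarith [hs.2])).ne'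

theorem Complex.hasSum_artanh {z : ℂ} (hz : ‖z‖ < 1) :
    HasSum (fun j : ℕ => z ^ (2 * j + 1) / (2 * j + 1))
      ((Complex.log (1 + z) - Complex.log (1 - z)) / 2) := by
  have h := ((Complex.hasSum_taylorSeries_log hz).add
    (Complex.hasSum_taylorSeries_neg_log hz)).div_const 2
  have hinj : Function.Injective fun j : ℕ => 2 * j + 1 := fun a b hab => by
    simpa using hab
  rw [← hinj.hasSum_iff] at h
  · rw [sub_eq_add_neg]
    refine h.congr_fun ?_
    intro j
    simp only [Function.comp]
    rw [Even.neg_one_pow ⟨j + 1, by ring⟩]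
    push_cast
    ring
  · intro n hn
    have he : Even n := by
      rw [← Nat.not_odd_iff_even]
      rintro ⟨j, rfl⟩
      exact hn ⟨j, rfl⟩
    rw [Odd.neg_one_pow he.add_one]
    ring

theorem two_mul_natCast_sub_one_ne_zero (j : ℕ) : (2 * (j : ℂ) - 1) ≠ 0 := by
  have : (2 * (j : ℤ) - 1) ≠ 0 := by omega
  exact_mod_cast this

theorem two_mul_natCast_add_one_ne_zero (j : ℕ) : (2 * (j : ℂ) + 1) ≠ 0 := by
  have : (2 * (j : ℤ) + 1) ≠ 0 := by omega
  exact_mod_cast this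

theorem two_mul_natCast_add_three_ne_zero (j : ℕ) : (2 * (j : ℂ) + 3) ≠ 0 := by
  have : (2 * (j : ℤ) + 3) ≠ 0 := by omega
  exact_mod_cast this

theorem hasSum_cubic_of_norm_lt_one {z : ℂ} (hz : ‖z‖ < 1) :
    HasSum (fun j : ℕ => z ^ 2 *
        (z ^ (2 * j + 1) / ((2 * j - 1) * (2 * j + 1) * (2 * j + 3))))
      (((z ^ 2 - 1) ^ 2 * ((Complex.log (1 + z) - Complex.log (1 - z)) / 2) - z ^ 3 - z) / 8) := by
  set A := (Complex.log (1 + z) - Complex.log (1 - z)) / 2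
  have h := Complex.hasSum_artanh hz
  have h1 : HasSum (fun j : ℕ => z ^ (2 * j + 3) / (2 * j + 3)) (A - z) := by
    have := (hasSum_nat_add_iff' 1).2 h
    simp only [Finset.sum_range_one] at this
    convert! this using 1
    · funext j; push_cast; ring
    · simp [A]
  have h2 : HasSum (fun j : ℕ => z ^ (2 * j + 1) / (2 * j - 1)) (z ^ 2 * A - z) := by
    rw [← hasSum_nat_add_iff' 1]
    simp only [Finset.sum_range_one]
    convert! h.mul_left (z ^ 2) using 1
    · funext j; push_cast; ring
    · simp only [A]
      norm_num
      ring
  have := (((h2.mul_left (z ^ 2)).sub (h.mul_left (2 * z ^ 2))).add h1).div_const 8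
  convert! this using 1
  · funext j
    have := two_mul_natCast_sub_one_ne_zero j
    have := two_mul_natCast_add_one_ne_zero j
    have := two_mul_natCast_add_three_ne_zero j
    field_simp
    ring
  · ring

theorem norm_inv_cubic_le (j : ℕ) :
    ‖(1 : ℂ) / ((2 * j - 1) * (2 * j + 1) * (2 * j + 3))‖ ≤ 1 / ((j + 1 : ℕ) : ℝ) ^ 2 := by
  rw [norm_div, norm_one]
  refine one_div_le_one_div_of_le (by positivity) ?_
  have h : ((2 * (j : ℂ) - 1) * (2 * j + 1) * (2 * j + 3))
      = (((2 * (j : ℝ) - 1) * (2 * j + 1) * (2 * j + 3) : ℝ) : ℂ) := by push_cast; ring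
  rw [h, Complex.norm_real, Real.norm_eq_abs]
  rcases j with _ | j
  · norm_num
  · refine le_trans ?_ (le_abs_self _)
    push_cast
    have : (0 : ℝ) ≤ j := j.cast_nonneg
    nlinarith [mul_nonneg this this, mul_nonneg (mul_nonneg this this) this]

theorem summable_inv_succ_sq : Summable fun j : ℕ => 1 / ((j + 1 : ℕ) : ℝ) ^ 2 :=
  (summable_nat_add_iff 1).2 (Real.summable_one_div_nat_pow.2 one_lt_two)

theorem norm_cubic_term_le {z : ℂ} (hz : ‖z‖ ≤ 1) (j : ℕ) :
    ‖z ^ (2 * j + 1) / ((2 * j - 1) * (2 * j + 1) * (2 * j + 3))‖ ≤ 1 / ((j + 1 : ℕ) : ℝ) ^ 2 := by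
  rw [div_eq_mul_one_div, norm_mul, norm_pow]
  exact (mul_le_of_le_one_left (norm_nonneg _) (pow_le_one₀ (norm_nonneg _) hz)).trans
    (norm_inv_cubic_le j)

theorem summable_cubic {z : ℂ} (hz : ‖z‖ ≤ 1) :
    Summable fun j : ℕ => z ^ (2 * j + 1) / ((2 * j - 1) * (2 * j + 1) * (2 * j + 3)) :=
  Summable.of_norm_bounded summable_inv_succ_sq (norm_cubic_term_le hz)

theorem tsum_cubic_of_norm_eq_one {z : ℂ} (hz : ‖z‖ = 1) (hre : |z.re| < 1) :
    z ^ 2 * ∑' j : ℕ, z ^ (2 * j + 1) / ((2 * j - 1) * (2 * j + 1) * (2 * j + 3))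
      = ((z ^ 2 - 1) ^ 2 * ((Complex.log (1 + z) - Complex.log (1 - z)) / 2) - z ^ 3 - z) / 8 := by
  have hz' : z ∈ Metric.closedBall (0 : ℂ) 1 := by simp [hz]
  have hc : ContinuousOn (fun z : ℂ => z ^ 2 * ∑' j : ℕ,
      z ^ (2 * j + 1) / ((2 * j - 1) * (2 * j + 1) * (2 * j + 3))) (Metric.closedBall 0 1) :=
    (continuousOn_id.pow 2).mul <| continuousOn_tsum (fun j => by fun_prop)
      summable_inv_succ_sq fun j w hw => norm_cubic_term_le (by simpa using hw) j
  have h1 := ((hc z hz').mono Metric.ball_subset_closedBall).tendsto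
  rw [abs_lt] at hre
  have hp : 1 + z ∈ Complex.slitPlane := .inl (by simp; linarith)
  have hm : 1 - z ∈ Complex.slitPlane := .inl (by simp; linarith)
  have h2 : ContinuousAt (fun z : ℂ => ((z ^ 2 - 1) ^ 2 *
      ((Complex.log (1 + z) - Complex.log (1 - z)) / 2) - z ^ 3 - z) / 8) z := by
    fun_prop (disch := assumption)
  have : (nhdsWithin z (Metric.ball 0 1)).NeBot := by
    rw [← mem_closure_iff_nhdsWithin_neBot, closure_ball _ one_ne_zero]
    exact hz'
  refine tendsto_nhds_unique h1 ((h2.tendsto.mono_left nhdsWithin_le_nhds).congr' ?_)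
  filter_upwards [self_mem_nhdsWithin] with w hw
  have hw : ‖w‖ < 1 := by simpa using hw
  rw [← (hasSum_cubic_of_norm_lt_one hw).tsum_eq, tsum_mul_left]

theorem re_tsum_cubic {s : ℝ} (hs : s ∈ Set.Ioo 0 π) :
    (∑' j : ℕ, Complex.exp (Complex.I * s) ^ (2 * j + 1)
        / ((2 * j - 1) * (2 * j + 1) * (2 * j + 3))).re
      = (Real.sin s ^ 2 * Real.log (Real.tan (s / 2)) - Real.cos s) / 4 := by
  set z := Complex.exp (Complex.I * s) with hzdef
  have hzs : z = Real.cos s + Real.sin s * Complex.I := by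
    rw [hzdef, mul_comm, Complex.exp_mul_I, Complex.ofReal_cos, Complex.ofReal_sin]
  have hz : ‖z‖ = 1 := by rw [hzdef, mul_comm, Complex.norm_exp_ofReal_mul_I]
  have hsin := Real.sin_pos_of_mem_Ioo hs
  have hre : z.re = Real.cos s := by
    simp [hzs, -Complex.ofReal_cos, -Complex.ofReal_sin]
  have hsq := Real.sin_sq_add_cos_sq s
  have hlt : |z.re| < 1 := by
    rw [hre, ← sq_lt_one_iff_abs_lt_one]; nlinarith
  have hz0 : z ≠ 0 := Complex.exp_ne_zero _
  have hcs : (Real.sin s : ℂ) ^ 2 + (Real.cos s : ℂ) ^ 2 = 1 := by exact_mod_cast hsq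
  have hmain := tsum_cubic_of_norm_eq_one hz hlt
  set A := (Complex.log (1 + z) - Complex.log (1 - z)) / 2 with hA
  have h1 : (z ^ 2 - 1) = 2 * Complex.I * Real.sin s * z := by
    rw [hzs]; linear_combination hcs - (Real.sin s : ℂ) ^ 2 * Complex.I_sq
  have h2 : z ^ 3 + z = 2 * Real.cos s * z ^ 2 := by
    have : z ^ 2 + 1 = 2 * Real.cos s * z := by
      rw [hzs]; linear_combination - hcs + (Real.sin s : ℂ) ^ 2 * Complex.I_sq
    linear_combination z * this
  have h3 : ∑' j : ℕ, z ^ (2 * j + 1) / ((2 * j - 1) * (2 * j + 1) * (2 * j + 3))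
      = -((Real.sin s ^ 2 / 2 : ℝ) : ℂ) * A - ((Real.cos s / 4 : ℝ) : ℂ) := by
    apply mul_left_cancel₀ (pow_ne_zero 2 hz0)
    rw [hmain, h1, sub_sub, h2]
    push_cast [-Complex.ofReal_sin, -Complex.ofReal_cos]
    linear_combination (Real.sin s : ℂ) ^ 2 * z ^ 2 * A / 2 * Complex.I_sq
  have hAre : A.re = -Real.log (Real.tan (s / 2)) / 2 := by
    have hn : ∀ w : ℂ, Real.log ‖w‖ = Real.log (‖w‖ ^ 2) / 2 := fun w => by
      rw [Real.log_pow]; push_cast; ring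
    have hc2 : 0 < Real.cos (s / 2) :=
      Real.cos_pos_of_mem_Ioo ⟨by linarith [hs.1, Real.pi_pos], by linarith [hs.2]⟩
    have hs2 : 0 < Real.sin (s / 2) :=
      Real.sin_pos_of_pos_of_lt_pi (by linarith [hs.1]) (by linarith [hs.1, hs.2])
    have hcos : Real.cos s = 2 * Real.cos (s / 2) ^ 2 - 1 := by
      rw [← Real.cos_two_mul]; congr 1; ring
    have hsq2 := Real.sin_sq_add_cos_sq (s / 2)
    have hp : ‖1 + z‖ ^ 2 = 4 * Real.cos (s / 2) ^ 2 := by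
      rw [Complex.sq_norm, hzs, Complex.normSq_apply]
      simp [-Complex.ofReal_cos, -Complex.ofReal_sin]
      nlinarith
    have hm : ‖1 - z‖ ^ 2 = 4 * Real.sin (s / 2) ^ 2 := by
      rw [Complex.sq_norm, hzs, Complex.normSq_apply]
      simp [-Complex.ofReal_cos, -Complex.ofReal_sin]
      nlinarith
    have : A.re = (Real.log ‖1 + z‖ - Real.log ‖1 - z‖) / 2 := by
      rw [hA, show (2 : ℂ) = ((2 : ℝ) : ℂ) by simp, Complex.div_ofReal_re, Complex.sub_re,
        Complex.log_re, Complex.log_re]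
    rw [this, hn, hn, hp, hm, Real.tan_eq_sin_div_cos, Real.log_div hs2.ne' hc2.ne',
      Real.log_mul (by norm_num) (by positivity), Real.log_mul (by norm_num) (by positivity),
      Real.log_pow, Real.log_pow]
    push_cast
    ring
  rw [h3, ← Complex.ofReal_neg, Complex.sub_re, Complex.re_ofReal_mul, Complex.ofReal_re, hAre]
  ring

theorem odd_sub_two_mul_ne_zero {k : ℤ} (hk : Odd k) (l : ℤ) :
    (k : ℂ) - 2 * l ≠ 0 ∧ (k : ℂ) - 2 * l - 2 ≠ 0 ∧ (k : ℂ) - 2 * l + 2 ≠ 0 := by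
  obtain ⟨n, rfl⟩ := hk
  have h1 : (2 * n + 1 - 2 * l : ℤ) ≠ 0 := by omega
  have h2 : (2 * n + 1 - 2 * l - 2 : ℤ) ≠ 0 := by omega
  have h3 : (2 * n + 1 - 2 * l + 2 : ℤ) ≠ 0 := by omega
  exact ⟨by exact_mod_cast h1, by exact_mod_cast h2, by exact_mod_cast h3⟩

/-- The `l`-th term of the series, with the convention that it vanishes at `l = 0`. -/
noncomputable def seriesTerm (s : ℝ) (k l : ℤ) : ℂ :=
  4 * (Int.sign l : ℂ) * Complex.exp (2 * Complex.I * (l : ℂ) * (s : ℂ))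
    / (((k : ℂ) - 2 * (l : ℂ)) * (((k : ℂ) - 2 * (l : ℂ)) ^ 2 - 4))

/-- The integrand of the principal value integral. -/
noncomputable def kernel (s : ℝ) (k : ℤ) (η : ℝ) : ℂ :=
  (Real.sin η : ℂ) * Complex.exp (Complex.I * (k : ℂ) * (η : ℂ)) / (Real.sin (s - η) : ℂ)

/-- The expansion at a fixed frequency `k`, together with convergence of both sides. -/
def HasExpansion (s : ℝ) (k : ℤ) : Prop :=
  ∃ I X : ℂ, Tendsto (fun ε : ℝ => ∫ η in {η : ℝ | η ∈ Set.Ioo 0 π ∧ ε < |η - s|}, kernel s k η)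
      (nhdsWithin 0 (Set.Ioi 0)) (nhds I) ∧
    HasSum (seriesTerm s k) X ∧ (Real.sin s : ℂ) * I = -2 / ((k : ℂ) ^ 2 - 4) - X

theorem integral_sin_mul_exp {m : ℤ} (hm : Even m) :
    ∫ η in 0..π, (Real.sin η : ℂ) * Complex.exp (Complex.I * (m : ℂ) * (η : ℂ))
      = -2 / (((m : ℂ) + 1) * ((m : ℂ) - 1)) := by
  have h1 : (m : ℂ) + 1 ≠ 0 := by
    have : m + 1 ≠ 0 := by rintro h; obtain ⟨n, rfl⟩ := hm; omega
    exact_mod_cast this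
  have h2 : (m : ℂ) - 1 ≠ 0 := by
    have : m - 1 ≠ 0 := by rintro h; obtain ⟨n, rfl⟩ := hm; omega
    exact_mod_cast this
  have he : Complex.exp (Complex.I * m * π) = 1 := by
    obtain ⟨n, rfl⟩ := hm
    rw [Complex.exp_eq_one_iff]
    exact ⟨n, by push_cast; ring⟩
  have hd : ∀ η ∈ uIcc 0 π, HasDerivAt (fun η : ℝ => Complex.exp (Complex.I * m * η) *
      (Complex.I * m * Complex.sin η - Complex.cos η) / (1 - (m : ℂ) ^ 2))
      ((Real.sin η : ℂ) * Complex.exp (Complex.I * (m : ℂ) * (η : ℂ))) η := by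
    intro η _
    have e1 : HasDerivAt (fun w : ℂ => Complex.exp (Complex.I * m * w) *
      (Complex.I * m * Complex.sin w - Complex.cos w) / (1 - (m : ℂ) ^ 2))
      (Complex.sin η * Complex.exp (Complex.I * m * η)) (η : ℂ) := by
      have a1 := ((hasDerivAt_id (η : ℂ)).const_mul (Complex.I * m)).cexp
      have a2 := ((Complex.hasDerivAt_sin η).const_mul (Complex.I * m)).sub
        (Complex.hasDerivAt_cos η)
      refine ((a1.mul a2).div_const (1 - (m : ℂ) ^ 2)).congr_deriv ?_
      have h3 : 1 - (m : ℂ) ^ 2 ≠ 0 := by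
        rw [show 1 - (m : ℂ) ^ 2 = -((m + 1) * (m - 1)) by ring]
        exact neg_ne_zero.2 (mul_ne_zero h1 h2)
      rw [div_eq_iff h3]
      simp only [id, Pi.sub_apply]
      linear_combination (Complex.exp (Complex.I * m * η) * m ^ 2 * Complex.sin η) * Complex.I_sq
    simpa using e1.comp_ofReal
  rw [intervalIntegral.integral_eq_sub_of_hasDerivAt hd
    (Continuous.intervalIntegrable (by fun_prop) _ _)]
  have h3 : 1 - (m : ℂ) ^ 2 ≠ 0 := by
    rw [show 1 - (m : ℂ) ^ 2 = -((m + 1) * (m - 1)) by ring]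
    exact neg_ne_zero.2 (mul_ne_zero h1 h2)
  rw [he]
  simp
  field_simp
  ring

theorem two_I_mul_exp_mul_exp_mul_sin_sub (x y : ℂ) :
    2 * Complex.I * Complex.exp (Complex.I * x) * Complex.exp (Complex.I * y) *
      Complex.sin (x - y) = Complex.exp (Complex.I * x) ^ 2 - Complex.exp (Complex.I * y) ^ 2 := by
  have e1 : Complex.exp (-(x - y) * Complex.I) * Complex.exp (Complex.I * x)
      = Complex.exp (Complex.I * y) := by rw [← Complex.exp_add]; congr 1; ring
  have e2 : Complex.exp ((x - y) * Complex.I) * Complex.exp (Complex.I * y)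
      = Complex.exp (Complex.I * x) := by rw [← Complex.exp_add]; congr 1; ring
  rw [Complex.sin]
  linear_combination -(Complex.exp (Complex.I * y)) * e1 + (Complex.exp (Complex.I * x)) * e2 +
    (Complex.exp (-(x - y) * Complex.I) - Complex.exp ((x - y) * Complex.I)) *
    Complex.exp (Complex.I * x) * Complex.exp (Complex.I * y) * Complex.I_sq

theorem kernel_add_two {s η : ℝ} (k : ℤ) (h : Real.sin (s - η) ≠ 0) :
    kernel s (k + 2) η = Complex.exp (2 * Complex.I * s) * kernel s k η
      - 2 * Complex.I * Complex.exp (Complex.I * s) *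
        ((Real.sin η : ℂ) * Complex.exp (Complex.I * ((k + 1 : ℤ) : ℂ) * (η : ℂ))) := by
  have h' : Complex.sin (s - η) ≠ 0 := by exact_mod_cast h
  have hk : Complex.exp (Complex.I * ((k + 2 : ℤ) : ℂ) * η)
      = Complex.exp (Complex.I * k * η) * Complex.exp (Complex.I * η) ^ 2 := by
    rw [← Complex.exp_nat_mul, ← Complex.exp_add]; congr 1; push_cast; ring
  have hk1 : Complex.exp (Complex.I * ((k + 1 : ℤ) : ℂ) * η)
      = Complex.exp (Complex.I * k * η) * Complex.exp (Complex.I * η) := by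
    rw [← Complex.exp_add]; congr 1; push_cast; ring
  have hs : Complex.exp (2 * Complex.I * s) = Complex.exp (Complex.I * s) ^ 2 := by
    rw [← Complex.exp_nat_mul]; congr 1; push_cast; ring
  have hsin := two_I_mul_exp_mul_exp_mul_sin_sub s η
  unfold kernel
  push_cast at hk hk1 ⊢
  rw [hk, hk1, hs]
  field_simp
  linear_combination Complex.sin η * hsin

theorem measurableSet_truncated (s ε : ℝ) :
    MeasurableSet {η : ℝ | η ∈ Set.Ioo 0 π ∧ ε < |η - s|} :=
  measurableSet_Ioo.inter
    (measurableSet_lt (f := fun _ => ε) (g := fun η => |η - s|) (by fun_prop) (by fun_prop))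

theorem setIntegral_kernel_add_two {s ε : ℝ} (hs : s ∈ Set.Ioo 0 π) (hε : 0 < ε) (k : ℤ) :
    ∫ η in {η : ℝ | η ∈ Set.Ioo 0 π ∧ ε < |η - s|}, kernel s (k + 2) η
      = Complex.exp (2 * Complex.I * s) *
          (∫ η in {η : ℝ | η ∈ Set.Ioo 0 π ∧ ε < |η - s|}, kernel s k η)
        - 2 * Complex.I * Complex.exp (Complex.I * s) *
          ∫ η in {η : ℝ | η ∈ Set.Ioo 0 π ∧ ε < |η - s|},
            ((Real.sin η : ℂ) * Complex.exp (Complex.I * ((k + 1 : ℤ) : ℂ) * (η : ℂ))) := by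
  rw [setIntegral_congr_fun (measurableSet_truncated s ε)
    fun η hη => kernel_add_two k (sin_sub_ne_zero hs hε (truncated_subset s ε hη)), integral_sub,
    integral_const_mul, integral_const_mul]
  · exact (integrableOn_div_sin_sub s hs (by fun_prop) hε).const_mul _
  · exact (integrableOn_truncated (by fun_prop)).const_mul _

theorem seriesTerm_add_two (s : ℝ) (k l : ℤ) :
    seriesTerm s (k + 2) (l + 1) = Complex.exp (2 * Complex.I * s) * (seriesTerm s k l
      + if l ∈ ({0, -1} : Finset ℤ) then 4 * Complex.exp (2 * Complex.I * (l : ℂ) * (s : ℂ))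
        / (((k : ℂ) - 2 * (l : ℂ)) * (((k : ℂ) - 2 * (l : ℂ)) ^ 2 - 4)) else 0) := by
  have he : Complex.exp (2 * Complex.I * ((l + 1 : ℤ) : ℂ) * (s : ℂ))
      = Complex.exp (2 * Complex.I * s) * Complex.exp (2 * Complex.I * (l : ℂ) * (s : ℂ)) := by
    rw [← Complex.exp_add]; congr 1; push_cast; ring
  have hd : ((k + 2 : ℤ) : ℂ) - 2 * ((l + 1 : ℤ) : ℂ) = k - 2 * l := by push_cast; ring
  unfold seriesTerm
  rw [he, hd]
  rcases lt_trichotomy l 0 with h | rfl | h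
  · rcases (show l + 1 ≤ 0 by omega).lt_or_eq with h' | h'
    · have : l ∉ ({0, -1} : Finset ℤ) := by simp; omega
      rw [if_neg this, Int.sign_eq_neg_one_of_neg h, Int.sign_eq_neg_one_of_neg h']
      ring
    · obtain rfl : l = -1 := by omega
      simp
      ring
  · simp
    ring
  · have : l ∉ ({0, -1} : Finset ℤ) := by simp; omega
    rw [if_neg this, Int.sign_eq_one_of_pos h, Int.sign_eq_one_of_pos (by omega : 0 < l + 1)]
    ring

theorem hasSum_seriesTerm_add_two_iff (s : ℝ) (k : ℤ) (X : ℂ) :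
    HasSum (seriesTerm s (k + 2)) (Complex.exp (2 * Complex.I * s) * (X + 4 / (k * (k ^ 2 - 4)))
        + 4 / ((k + 2) * ((k + 2) ^ 2 - 4))) ↔ HasSum (seriesTerm s k) X := by
  set g : ℤ → ℂ := fun l => if l ∈ ({0, -1} : Finset ℤ) then
    4 * Complex.exp (2 * Complex.I * (l : ℂ) * (s : ℂ))
        / (((k : ℂ) - 2 * (l : ℂ)) * (((k : ℂ) - 2 * (l : ℂ)) ^ 2 - 4)) else 0 with hg
  have hgs : HasSum g (4 / (k * (k ^ 2 - 4))
      + 4 * Complex.exp (-(2 * Complex.I * s)) / ((k + 2) * ((k + 2) ^ 2 - 4))) := by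
    have : HasSum g (∑ l ∈ ({0, -1} : Finset ℤ), g l) :=
      hasSum_sum_of_ne_finset_zero fun l hl => if_neg hl
    rw [Finset.sum_pair (by decide)] at this
    simpa [hg] using this
  rw [← (Equiv.addRight (1 : ℤ)).hasSum_iff]
  have hfun : seriesTerm s (k + 2) ∘ Equiv.addRight (1 : ℤ)
      = fun l => Complex.exp (2 * Complex.I * s) * (seriesTerm s k l + g l) := by
    funext l
    exact seriesTerm_add_two s k l
  have hX : Complex.exp (2 * Complex.I * s) * (X + 4 / (k * (k ^ 2 - 4)))
        + 4 / ((k + 2) * ((k + 2) ^ 2 - 4))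
      = Complex.exp (2 * Complex.I * s) * (X + (4 / (k * (k ^ 2 - 4))
      + 4 * Complex.exp (-(2 * Complex.I * s)) / ((k + 2) * ((k + 2) ^ 2 - 4)))) := by
    have := Complex.exp_neg (2 * Complex.I * s)
    have h0 := Complex.exp_ne_zero (2 * Complex.I * s)
    rw [this]
    generalize (k + 2 : ℂ) * ((k + 2) ^ 2 - 4) = d
    field_simp
    ring
  rw [hfun, hX, hasSum_mul_left_iff (Complex.exp_ne_zero _)]
  constructor
  · intro h
    simpa using h.sub hgs
  · exact fun h => h.add hgs

theorem hasExpansion_add_two_iff {k : ℤ} (hk : Odd k) {s : ℝ} (hs : s ∈ Set.Ioo 0 π) :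
    HasExpansion s (k + 2) ↔ HasExpansion s k := by
  obtain ⟨ha, hb, hc⟩ := odd_sub_two_mul_ne_zero hk 0
  obtain ⟨-, -, hd⟩ := odd_sub_two_mul_ne_zero hk (-1)
  simp only [Int.cast_zero, mul_zero, sub_zero, Int.cast_neg, Int.cast_one] at ha hb hc hd
  replace hd : (k : ℂ) + 4 ≠ 0 := by convert! hd using 1; ring
  have hJ := tendsto_setIntegral_truncated hs (f := fun η =>
    (Real.sin η : ℂ) * Complex.exp (Complex.I * ((k + 1 : ℤ) : ℂ) * (η : ℂ))) (by fun_prop)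
  rw [integral_sin_mul_exp hk.add_one] at hJ
  have hJ' : (-2 / ((((k + 1 : ℤ) : ℂ) + 1) * (((k + 1 : ℤ) : ℂ) - 1)) : ℂ)
      = -2 / (k * (k + 2)) := by push_cast; congr 1; ring
  rw [hJ'] at hJ
  set E := Complex.exp (Complex.I * s) with hE
  have hE0 : E ≠ 0 := Complex.exp_ne_zero _
  have hE2 : Complex.exp (2 * Complex.I * s) = E ^ 2 := by
    rw [hE, ← Complex.exp_nat_mul]; congr 1; push_cast; ring
  have hsin : 2 * Complex.I * E * Real.sin s = E ^ 2 - 1 := by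
    simpa using two_I_mul_exp_mul_exp_mul_sin_sub s 0
  have hfour : (k : ℂ) ^ 2 - 4 = (k - 2) * (k + 2) := by ring
  have hfour' : ((k : ℂ) + 2) ^ 2 - 4 = k * (k + 4) := by ring
  have key : ∀ I X : ℂ, ((Real.sin s : ℂ) * (E ^ 2 * I - 2 * Complex.I * E * (-2 / (k * (k + 2))))
      = -2 / (((k + 2 : ℤ) : ℂ) ^ 2 - 4) - (E ^ 2 * (X + 4 / (k * (k ^ 2 - 4)))
        + 4 / ((k + 2) * ((k + 2) ^ 2 - 4)))) ↔
      (Real.sin s : ℂ) * I = -2 / ((k : ℂ) ^ 2 - 4) - X := by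
    intro I X
    rw [← mul_right_inj' (pow_ne_zero 2 hE0) (b := (Real.sin s : ℂ) * I), ← sub_eq_zero,
      ← sub_eq_zero (a := E ^ 2 * ((Real.sin s : ℂ) * I))]
    have : (Real.sin s : ℂ) * (E ^ 2 * I - 2 * Complex.I * E * (-2 / (k * (k + 2)))) -
        (-2 / (((k + 2 : ℤ) : ℂ) ^ 2 - 4) - (E ^ 2 * (X + 4 / (k * (k ^ 2 - 4)))
        + 4 / ((k + 2) * ((k + 2) ^ 2 - 4))))
        = E ^ 2 * ((Real.sin s : ℂ) * I) - E ^ 2 * (-2 / ((k : ℂ) ^ 2 - 4) - X) := by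
      have : (Real.sin s : ℂ) * (E ^ 2 * I - 2 * Complex.I * E * (-2 / (k * (k + 2))))
          = E ^ 2 * ((Real.sin s : ℂ) * I) + (E ^ 2 - 1) * (2 / (k * (k + 2))) := by
        rw [← hsin]; ring
      rw [this]
      push_cast
      rw [hfour, hfour']
      field_simp
      ring
    rw [this]
  constructor
  · rintro ⟨I, X, hI, hX, hIX⟩
    refine ⟨(I + 2 * Complex.I * E * (-2 / (k * (k + 2)))) / E ^ 2,
      (X - 4 / ((k + 2) * ((k + 2) ^ 2 - 4))) / E ^ 2 - 4 / (k * (k ^ 2 - 4)), ?_, ?_, ?_⟩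
    · refine ((hI.add (hJ.const_mul (2 * Complex.I * E))).div_const (E ^ 2)).congr' ?_
      filter_upwards [self_mem_nhdsWithin] with ε hε
      rw [setIntegral_kernel_add_two hs hε, ← hE, hE2]
      field_simp
      ring
    · rw [← hasSum_seriesTerm_add_two_iff, hE2]
      convert! hX using 1
      field_simp
      ring
    · rw [← key]
      convert! hIX using 1
      · field_simp
        ring
      · congr 1
        field_simp
        ring
  · rintro ⟨I, X, hI, hX, hIX⟩
    refine ⟨E ^ 2 * I - 2 * Complex.I * E * (-2 / (k * (k + 2))), _, ?_,
      (hasSum_seriesTerm_add_two_iff s k X).2 hX, ?_⟩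
    · refine ((hI.const_mul (E ^ 2)).sub (hJ.const_mul (2 * Complex.I * E))).congr' ?_
      filter_upwards [self_mem_nhdsWithin] with ε hε
      rw [setIntegral_kernel_add_two hs hε, ← hE, hE2]
    · rw [hE2]
      exact (key I X).2 hIX

theorem hasSum_seriesTerm_one {s : ℝ} (hs : s ∈ Set.Ioo 0 π) :
    HasSum (seriesTerm s 1) (-4 / 3 - 2 * Complex.exp (Complex.I * s) *
      ((Real.sin s ^ 2 * Real.log (Real.tan (s / 2)) - Real.cos s : ℝ) : ℂ)) := by
  set z := Complex.exp (Complex.I * s) with hz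
  have hz1 : ‖z‖ = 1 := by rw [hz, mul_comm, Complex.norm_exp_ofReal_mul_I]
  have hpow : ∀ l : ℤ, Complex.exp (2 * Complex.I * (l : ℂ) * (s : ℂ)) = z ^ (2 * l) := by
    intro l
    rw [hz, ← Complex.exp_int_mul]; congr 1; push_cast; ring
  have hz0 : z ≠ 0 := Complex.exp_ne_zero _
  have hconj : (starRingEnd ℂ) z = z⁻¹ := (Complex.inv_eq_conj hz1).symm
  set T := ∑' j : ℕ, z ^ (2 * j + 1) / ((2 * j - 1) * (2 * j + 1) * (2 * j + 3)) with hT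
  have h1 : HasSum (fun j : ℕ => z ^ (2 * j + 1) / ((2 * j - 1) * (2 * j + 1) * (2 * j + 3))) T :=
    (summable_cubic hz1.le).hasSum
  have h2 : HasSum (fun j : ℕ => (z⁻¹) ^ (2 * j + 1) / ((2 * j - 1) * (2 * j + 1) * (2 * j + 3)))
      ((starRingEnd ℂ) T) := by
    have := (Complex.hasSum_conj' (f := fun j : ℕ =>
      z ^ (2 * j + 1) / ((2 * j - 1) * (2 * j + 1) * (2 * j + 3)))).2 h1
    simpa [hconj, Complex.conj_ofNat] using this
  have h3 := (hasSum_nat_add_iff' 1).2 h2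
  simp only [Finset.sum_range_one] at h3
  have hTT : T + (starRingEnd ℂ) T = ((2 * T.re : ℝ) : ℂ) := Complex.add_conj T
  rw [re_tsum_cubic hs] at hTT
  have hpos : HasSum (fun n : ℕ => seriesTerm s 1 (n + 1)) (-4 * z * T) := by
    refine (h1.mul_left (-4 * z)).congr_fun fun j => ?_
    have hp : z ^ (2 * ((j : ℤ) + 1)) = z * z ^ (2 * j + 1) := by
      rw [← pow_succ', ← zpow_natCast]; congr 1
    have hd : (((1 : ℤ) : ℂ) - 2 * (((j : ℤ) + 1 : ℤ) : ℂ)) *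
        ((((1 : ℤ) : ℂ) - 2 * (((j : ℤ) + 1 : ℤ) : ℂ)) ^ 2 - 4)
        = -((2 * j - 1) * (2 * j + 1) * (2 * j + 3)) := by push_cast; ring
    rw [seriesTerm, hpow, hp, hd, Int.sign_eq_one_of_pos (by omega)]
    rw [div_neg]
    push_cast
    ring
  have hneg : HasSum (fun n : ℕ => seriesTerm s 1 (-(n + 1))) (-4 * z *
      ((starRingEnd ℂ) T - z⁻¹ ^ (2 * 0 + 1) /
        ((2 * ((0 : ℕ) : ℂ) - 1) * (2 * ((0 : ℕ) : ℂ) + 1) * (2 * ((0 : ℕ) : ℂ) + 3)))) := by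
    refine (h3.mul_left (-4 * z)).congr_fun fun j => ?_
    have hp : z ^ (2 * (-((j : ℤ) + 1))) = z * z⁻¹ ^ (2 * (j + 1) + 1) := by
      rw [pow_succ', mul_inv_cancel_left₀ hz0, inv_pow, ← zpow_natCast, ← zpow_neg]
      congr 1
    have hd : (((1 : ℤ) : ℂ) - 2 * ((-((j : ℤ) + 1) : ℤ) : ℂ)) *
        ((((1 : ℤ) : ℂ) - 2 * ((-((j : ℤ) + 1) : ℤ) : ℂ)) ^ 2 - 4)
        = (2 * ((j + 1 : ℕ) : ℂ) - 1) * (2 * ((j + 1 : ℕ) : ℂ) + 1) *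
          (2 * ((j + 1 : ℕ) : ℂ) + 3) := by push_cast; ring
    rw [seriesTerm, hpow, hp, hd, Int.sign_eq_neg_one_of_neg (by omega)]
    push_cast
    ring
  convert! hpos.of_add_one_of_neg_add_one hneg using 1
  have h0 : seriesTerm s 1 0 = 0 := by simp [seriesTerm]
  have h1' : z * (z⁻¹ ^ (2 * 0 + 1) /
      ((2 * ((0 : ℕ) : ℂ) - 1) * (2 * ((0 : ℕ) : ℂ) + 1) * (2 * ((0 : ℕ) : ℂ) + 3))) = -1 / 3 := by
    norm_num
    field_simp
  rw [h0]
  push_cast [-Complex.ofReal_sin, -Complex.ofReal_cos] at hTT ⊢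
  push_cast at h1'
  linear_combination 4 * z * hTT - 4 * h1'

theorem kernel_one {s η : ℝ} (h : Real.sin (s - η) ≠ 0) :
    kernel s 1 η = Real.sin s * Complex.exp (Complex.I * s) * (1 / (Real.sin (s - η) : ℂ))
      - Complex.exp (Complex.I * s) * Complex.exp (Complex.I * η) := by
  have h' : Complex.sin (s - η) ≠ 0 := by exact_mod_cast h
  have h1 := two_I_mul_exp_mul_exp_mul_sin_sub s η
  have h2 := two_I_mul_exp_mul_exp_mul_sin_sub s 0
  have h3 := two_I_mul_exp_mul_exp_mul_sin_sub η 0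
  simp only [mul_zero, Complex.exp_zero, sub_zero, mul_one, one_pow] at h2 h3
  unfold kernel
  push_cast
  rw [mul_one]
  field_simp
  apply mul_left_cancel₀ (mul_ne_zero two_ne_zero Complex.I_ne_zero)
  linear_combination h1 - h2 + h3

theorem hasExpansion_one {s : ℝ} (hs : s ∈ Set.Ioo 0 π) : HasExpansion s 1 := by
  have h1 := (tendsto_inv_sin hs).const_mul (Real.sin s * Complex.exp (Complex.I * s))
  have h2 := (tendsto_setIntegral_truncated hs (f := fun η => Complex.exp (Complex.I * η))
    (by fun_prop)).const_mul (Complex.exp (Complex.I * s))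
  refine ⟨_, _, (h1.sub h2).congr' ?_, hasSum_seriesTerm_one hs, ?_⟩
  · filter_upwards [self_mem_nhdsWithin] with ε hε
    rw [setIntegral_congr_fun (measurableSet_truncated s ε)
      fun η hη => kernel_one (sin_sub_ne_zero hs hε (truncated_subset s ε hη)), integral_sub,
      integral_const_mul, integral_const_mul]
    · exact (integrableOn_div_sin_sub s hs continuous_const hε).const_mul _
    · exact (integrableOn_truncated (by fun_prop)).const_mul _
  · rw [integral_exp_mul_complex Complex.I_ne_zero, mul_comm Complex.I (π : ℂ),
      Complex.exp_pi_mul_I]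
    have hE : Complex.exp (Complex.I * s) * (Real.cos s - Complex.I * Real.sin s) = 1 := by
      have hcs : (Real.sin s : ℂ) ^ 2 + (Real.cos s : ℂ) ^ 2 = 1 := by
        exact_mod_cast Real.sin_sq_add_cos_sq s
      rw [mul_comm Complex.I (s : ℂ), Complex.exp_mul_I, ← Complex.ofReal_cos, ← Complex.ofReal_sin]
      linear_combination hcs - (Real.sin s : ℂ) ^ 2 * Complex.I_sq
    have hI : (-1 - Complex.exp (Complex.I * ((0 : ℝ) : ℂ))) / Complex.I = 2 * Complex.I := by
      rw [div_eq_iff Complex.I_ne_zero]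
      simp only [Complex.ofReal_zero, mul_zero, Complex.exp_zero]
      linear_combination (-2 : ℂ) * Complex.I_sq
    rw [hI]
    push_cast [-Complex.ofReal_sin, -Complex.ofReal_cos]
    linear_combination 2 * hE

theorem hasExpansion_of_odd {k : ℤ} (hk : Odd k) {s : ℝ} (hs : s ∈ Set.Ioo 0 π) :
    HasExpansion s k := by
  obtain ⟨n, rfl⟩ := hk
  induction n with
  | zero => simpa using hasExpansion_one hs
  | succ n ih =>
    rw [show (2 * ((n : ℤ) + 1) + 1) = 2 * n + 1 + 2 by ring]
    exact (hasExpansion_add_two_iff ⟨n, rfl⟩ hs).2 ih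
  | pred n ih =>
    rw [← hasExpansion_add_two_iff ⟨_, rfl⟩ hs]
    convert! ih using 1
    ring

/-- Series expansion of the half-Laplacian of e^{iks} for odd k (formula (17) of the paper). -/
theorem stmt_8 (k : ℤ) (hk : Odd k) (s : ℝ) (hs : s ∈ Set.Ioo 0 π) :
    Summable (fun l : {l : ℤ // l ≠ 0} =>
      ‖4 * (Int.sign l.1 : ℂ) * Complex.exp (2 * Complex.I * (l.1 : ℂ) * (s : ℂ))
        / (((k : ℂ) - 2 * (l.1 : ℂ)) * (((k : ℂ) - 2 * (l.1 : ℂ)) ^ 2 - 4))‖) ∧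
    ∃ I : ℂ,
      Tendsto (fun ε : ℝ => ∫ η in {η : ℝ | η ∈ Set.Ioo 0 π ∧ ε < |η - s|},
          (Real.sin η : ℂ) * Complex.exp (Complex.I * (k : ℂ) * (η : ℂ))
            / (Real.sin (s - η) : ℂ))
        (nhdsWithin 0 (Set.Ioi 0)) (nhds I) ∧
      (Real.sin s : ℂ) * I
        = -2 / ((k : ℂ) ^ 2 - 4)
          - ∑' l : {l : ℤ // l ≠ 0},
              4 * (Int.sign l.1 : ℂ) * Complex.exp (2 * Complex.I * (l.1 : ℂ) * (s : ℂ))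
                / (((k : ℂ) - 2 * (l.1 : ℂ)) * (((k : ℂ) - 2 * (l.1 : ℂ)) ^ 2 - 4)) := by
  obtain ⟨I, X, hI, hX, hIX⟩ := hasExpansion_of_odd hk hs
  have hsub : HasSum (fun l : {l : ℤ // l ≠ 0} => seriesTerm s k l) X := by
    refine (Subtype.val_injective.hasSum_iff fun l hl => ?_).2 hX
    have : l = 0 := by simpa using hl
    simp [this, seriesTerm]
  refine ⟨hsub.summable.norm, I, hI, ?_⟩
  rw [hIX]
  congr 1
  exact hsub.tsum_eq.symm
end

section
/- Let α ∈ (0,1) ∪ (1,2), let k be an even integer and l an integer. Then ∫_0^π sin(η)^α·(−k²·sin(η) + 2ik·cos(η))·e^{i(k−2l)η} dη = (π·α·(1−α)·((α−1)k² + 4kl) / (2^{2+α}·sin(πα/2)·Γ(2−α))) · Γ((−1−α)/2 + |k/2 − l|)/Γ((3+α)/2 + |k/2 − l|). -/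
open MeasureTheory Filter Set Real intervalIntegral

/-- The total derivative `d/dη (sin η ^ (a + 1) * exp (i w η))` integrates to zero over `[0, π]`. -/
theorem integral_sin_rpow_mul_exp_deriv {a : ℝ} (ha : 0 < a) (w : ℂ) :
    ∫ η in (0:ℝ)..π, ((Real.sin η ^ a : ℝ) : ℂ)
      * ((a + 1) * (Real.cos η : ℂ) + Complex.I * w * (Real.sin η : ℂ))
      * Complex.exp (Complex.I * w * (η : ℂ)) = 0 := by
  have hderiv : ∀ η ∈ Set.uIcc (0:ℝ) π,
      HasDerivAt (fun η : ℝ => ((Real.sin η ^ (a + 1) : ℝ) : ℂ)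
          * Complex.exp (Complex.I * w * (η : ℂ)))
        (((Real.sin η ^ a : ℝ) : ℂ)
          * ((a + 1) * (Real.cos η : ℂ) + Complex.I * w * (Real.sin η : ℂ))
          * Complex.exp (Complex.I * w * (η : ℂ))) η := by
    intro η hη
    rw [Set.uIcc_of_le Real.pi_pos.le] at hη
    have hs : 0 ≤ Real.sin η := Real.sin_nonneg_of_mem_Icc hη
    have h1 := ((Real.hasDerivAt_sin η).rpow_const (p := a + 1)
      (Or.inr (by linarith))).ofReal_comp
    have h2 : HasDerivAt (fun η : ℝ => Complex.exp (Complex.I * w * (η : ℂ)))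
        (Complex.exp (Complex.I * w * (η : ℂ)) * (Complex.I * w * 1)) η :=
      ((Complex.ofRealCLM.hasDerivAt (x := η)).const_mul (Complex.I * w)).cexp
    convert! h1.mul h2 using 1
    rw [add_sub_cancel_right, Real.rpow_add_one' hs (by linarith)]
    push_cast
    ring
  rw [intervalIntegral.integral_eq_sub_of_hasDerivAt hderiv]
  · simp [Real.zero_rpow (by linarith : a + 1 ≠ 0)]
  · apply Continuous.intervalIntegrable
    have := Real.continuous_sin.rpow_const (fun _ => Or.inr ha.le : ∀ x, Real.sin x ≠ 0 ∨ 0 ≤ a)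
    fun_prop

theorem intervalIntegrable_sin_rpow_mul_exp {a : ℝ} (ha : 0 < a) (w : ℂ) :
    IntervalIntegrable (fun η : ℝ => ((Real.sin η ^ a : ℝ) : ℂ)
      * Complex.exp (Complex.I * w * (η : ℂ))) volume 0 π := by
  apply Continuous.intervalIntegrable
  have := Real.continuous_sin.rpow_const (fun _ => Or.inr ha.le : ∀ x, Real.sin x ≠ 0 ∨ 0 ≤ a)
  fun_prop

theorem integral_sin_rpow_mul_exp_recurrence {a : ℝ} (ha : 0 < a) (w : ℂ) :
    (a + w + 2) * (∫ η in (0:ℝ)..π, ((Real.sin η ^ a : ℝ) : ℂ)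
        * Complex.exp (Complex.I * (w + 2) * (η : ℂ)))
      + (a - w) * (∫ η in (0:ℝ)..π, ((Real.sin η ^ a : ℝ) : ℂ)
        * Complex.exp (Complex.I * w * (η : ℂ))) = 0 := by
  rw [← intervalIntegral.integral_const_mul, ← intervalIntegral.integral_const_mul,
    ← intervalIntegral.integral_add ((intervalIntegrable_sin_rpow_mul_exp ha _).const_mul _)
      ((intervalIntegrable_sin_rpow_mul_exp ha _).const_mul _)]
  have h := congrArg (fun z => (2 : ℂ) * z) (integral_sin_rpow_mul_exp_deriv ha (w + 1))
  simp only [mul_zero] at h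
  rw [← h, ← intervalIntegral.integral_const_mul]
  congr 1
  ext η
  have e1 : Complex.exp (Complex.I * (w + 2) * (η : ℂ))
      = Complex.exp (Complex.I * (w + 1) * η) * Complex.exp (η * Complex.I) := by
    rw [← Complex.exp_add]; ring_nf
  have e2 : Complex.exp (Complex.I * w * (η : ℂ))
      = Complex.exp (Complex.I * (w + 1) * η) * Complex.exp (-η * Complex.I) := by
    rw [← Complex.exp_add]; ring_nf
  rw [e1, e2, Complex.exp_mul_I, Complex.exp_mul_I, Complex.cos_neg, Complex.sin_neg]
  push_cast
  ring

/-- Evaluation of `∫ sin ^ (2 s - 1)` over `[0, π]` via the Beta integral. -/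
theorem integral_sin_rpow_eq_Gamma {s : ℝ} (hs : 1 < s) :
    ∫ η in (0:ℝ)..π, Real.sin η ^ (2 * s - 1)
      = 2 ^ (2 * s - 1) * (Real.Gamma s * Real.Gamma s / Real.Gamma (2 * s)) := by
  have hbeta : ((∫ t in (0:ℝ)..1, t ^ (s - 1) * (1 - t) ^ (s - 1) : ℝ) : ℂ)
      = Complex.betaIntegral s s := by
    rw [Complex.betaIntegral, ← intervalIntegral.integral_ofReal]
    refine intervalIntegral.integral_congr fun t ht => ?_
    rw [Set.uIcc_of_le zero_le_one] at ht
    push_cast [Complex.ofReal_cpow ht.1, Complex.ofReal_cpow (sub_nonneg.2 ht.2)]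
    rfl
  have hG : ∫ t in (0:ℝ)..1, t ^ (s - 1) * (1 - t) ^ (s - 1)
      = Real.Gamma s * Real.Gamma s / Real.Gamma (2 * s) := by
    rw [eq_div_iff (Real.Gamma_pos_of_pos (by linarith)).ne']
    have h := Complex.Gamma_mul_Gamma_eq_betaIntegral (s := s) (t := s)
      (by simpa using by linarith) (by simpa using by linarith)
    rw [← hbeta, ← Complex.ofReal_add, Complex.Gamma_ofReal, Complex.Gamma_ofReal] at h
    rw [two_mul, mul_comm]
    exact_mod_cast h.symm
  have hsub := intervalIntegral.integral_comp_mul_deriv (a := 0) (b := π)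
    (f := fun η => (1 - Real.cos η) / 2) (f' := fun η => Real.sin η / 2)
    (g := fun t => t ^ (s - 1) * (1 - t) ^ (s - 1))
    (fun η _ => by
      simpa using ((Real.hasDerivAt_cos η).const_sub 1).div_const 2)
    (by fun_prop)
    ((continuous_id.rpow_const fun _ => Or.inr (by linarith)).mul
      ((continuous_const.sub continuous_id).rpow_const fun _ => Or.inr (by linarith)))
  norm_num at hsub
  rw [← hG, ← hsub, ← intervalIntegral.integral_const_mul]
  refine intervalIntegral.integral_congr fun η hη => ?_
  rw [Set.uIcc_of_le Real.pi_pos.le] at hη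
  have hsin : 0 ≤ Real.sin η := Real.sin_nonneg_of_mem_Icc hη
  have hc1 : 0 ≤ (1 - Real.cos η) / 2 := by linarith [Real.cos_le_one η]
  have hc2 : 0 ≤ 1 - (1 - Real.cos η) / 2 := by linarith [Real.neg_one_le_cos η]
  have hprod : (1 - Real.cos η) / 2 * (1 - (1 - Real.cos η) / 2) = (Real.sin η / 2) ^ (2:ℝ) := by
    rw [Real.rpow_two]
    linear_combination (-1/4) * Real.sin_sq_add_cos_sq η
  rw [← Real.mul_rpow hc1 hc2, hprod, ← Real.rpow_mul (by positivity),
    ← Real.rpow_add_one' (by positivity) (by linarith),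
    show 2 * (s - 1) + 1 = 2 * s - 1 by ring, ← Real.mul_rpow (by norm_num) (by positivity)]
  congr 1
  ring

theorem integral_sin_rpow_eq_Gamma_neg {α : ℝ} (h0 : 0 < α) (h1 : α ≠ 1) (h2 : α < 2) :
    ∫ η in (0:ℝ)..π, Real.sin η ^ (α + 1)
      = -(π * α * (1 - α) * (α + 1)
            / (2 ^ (2 + α) * Real.sin (π * α / 2) * Real.Gamma (2 - α)))
        * (Real.Gamma ((-1 - α) / 2) / Real.Gamma ((3 + α) / 2)) := by
  have hint := integral_sin_rpow_eq_Gamma (s := (α + 2) / 2) (by linarith)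
  rw [show 2 * ((α + 2) / 2) - 1 = α + 1 by ring, show 2 * ((α + 2) / 2) = α + 2 by ring] at hint
  have hdup := Real.Gamma_mul_Gamma_add_half ((α + 2) / 2)
  rw [show (α + 2) / 2 + 1 / 2 = (3 + α) / 2 by ring, show 2 * ((α + 2) / 2) = α + 2 by ring,
    show 1 - (α + 2) = -(α + 1) by ring, Real.rpow_neg (by norm_num)] at hdup
  have hrefl := Real.Gamma_mul_Gamma_one_sub ((-1 - α) / 2)
  rw [show 1 - (-1 - α) / 2 = (3 + α) / 2 by ring,
    show π * ((-1 - α) / 2) = -(π * α / 2 + π / 2) by ring, Real.sin_neg,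
    Real.sin_add_pi_div_two] at hrefl
  have hrefl2 := Real.Gamma_mul_Gamma_one_sub α
  rw [show π * α = 2 * (π * α / 2) by ring, Real.sin_two_mul] at hrefl2
  have g1 : Real.Gamma (α + 2) = (α + 1) * (α * Real.Gamma α) := by
    rw [show α + 2 = α + 1 + 1 by ring, Real.Gamma_add_one (by linarith),
      Real.Gamma_add_one h0.ne']
  have g2 : Real.Gamma (2 - α) = (1 - α) * Real.Gamma (1 - α) := by
    rw [show 2 - α = 1 - α + 1 by ring, Real.Gamma_add_one (sub_ne_zero.2 h1.symm)]
  have p2 : (2:ℝ) ^ (2 + α) = 2 * 2 ^ (α + 1) := by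
    rw [show 2 + α = α + 1 + 1 by ring, Real.rpow_add_one (by norm_num)]; ring
  have hS : Real.sin (π * α / 2) ≠ 0 :=
    (Real.sin_pos_of_pos_of_lt_pi (by positivity) (by nlinarith [Real.pi_pos])).ne'
  have hC : Real.cos (π * α / 2) ≠ 0 := by
    intro hc
    rcases lt_or_gt_of_ne h1 with h | h
    · exact (Real.cos_pos_of_mem_Ioo ⟨by nlinarith [Real.pi_pos], by nlinarith [Real.pi_pos]⟩).ne' hc
    · exact (Real.cos_neg_of_pi_div_two_lt_of_lt (by nlinarith [Real.pi_pos])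
        (by nlinarith [Real.pi_pos])).ne hc
  have hG2 : Real.Gamma (2 - α) ≠ 0 := (Real.Gamma_pos_of_pos (by linarith)).ne'
  have hG1 : Real.Gamma (1 - α) ≠ 0 := fun h => hG2 (by rw [g2, h, mul_zero])
  have hGa : Real.Gamma α ≠ 0 := (Real.Gamma_pos_of_pos h0).ne'
  have hG3 : Real.Gamma ((3 + α) / 2) ≠ 0 := (Real.Gamma_pos_of_pos (by linarith)).ne'
  have hP : (2:ℝ) ^ (α + 1) ≠ 0 := by positivity
  have hα1 : 1 - α ≠ 0 := sub_ne_zero.2 h1.symm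
  have hπ : √π ^ 2 = π := Real.sq_sqrt Real.pi_pos.le
  have hα2 : α + 1 ≠ 0 := by linarith
  rw [eq_div_of_mul_eq hG3 hdup, g1] at hint
  rw [hint, eq_div_of_mul_eq hG3 hrefl, g2, p2, eq_div_of_mul_eq hG1 hrefl2]
  field_simp
  rw [hπ]

theorem integral_sin_rpow_mul_exp_even {α : ℝ} (h0 : 0 < α) (h1 : α ≠ 1) (h2 : α < 2) (n : ℕ)
    (w : ℂ) (hw : w = 2 * n ∨ w = -(2 * n)) :
    ∫ η in (0:ℝ)..π, ((Real.sin η ^ (α + 1) : ℝ) : ℂ) * Complex.exp (Complex.I * w * (η : ℂ))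
      = ((-(π * α * (1 - α) * (α + 1)
            / (2 ^ (2 + α) * Real.sin (π * α / 2) * Real.Gamma (2 - α)))
        * (Real.Gamma ((-1 - α) / 2 + n) / Real.Gamma ((3 + α) / 2 + n)) : ℝ) : ℂ) := by
  induction n generalizing w with
  | zero =>
    have hw0 : w = 0 := by simpa using hw
    subst hw0
    rw [Nat.cast_zero, add_zero, add_zero, ← integral_sin_rpow_eq_Gamma_neg h0 h1 h2,
      ← intervalIntegral.integral_ofReal]
    simp
  | succ n ih =>
    have hn : (0:ℝ) ≤ n := n.cast_nonneg
    have hpos : (3 + α) / 2 + n ≠ 0 := by positivity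
    have hne : (-1 - α) / 2 + n ≠ 0 := by
      intro h
      rcases n with _ | _ | n
      · norm_num at h; linarith
      · norm_num at h; exact h1 (by linarith)
      · push_cast at h; linarith [(n.cast_nonneg : (0:ℝ) ≤ n)]
    have hG : Real.Gamma ((3 + α) / 2 + n) ≠ 0 := (Real.Gamma_pos_of_pos (by positivity)).ne'
    rw [Nat.cast_add_one, ← add_assoc, ← add_assoc, Real.Gamma_add_one hne,
      Real.Gamma_add_one hpos]
    set K := -(π * α * (1 - α) * (α + 1)
      / (2 ^ (2 + α) * Real.sin (π * α / 2) * Real.Gamma (2 - α)))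
    have hc : ((α + 1 : ℝ) : ℂ) + 2 * n + 2 ≠ 0 := by
      have : (α + 1) + 2 * n + 2 ≠ 0 := by positivity
      exact_mod_cast this
    have hstep : ∀ X Y : ℂ, (((α + 1 : ℝ) : ℂ) + 2 * n + 2) * X
          + (((α + 1 : ℝ) : ℂ) - 2 * n) * Y = 0 →
        Y = ((K * (Real.Gamma ((-1 - α) / 2 + n) / Real.Gamma ((3 + α) / 2 + n)) : ℝ) : ℂ) →
        X = ((K * (((-1 - α) / 2 + n) * Real.Gamma ((-1 - α) / 2 + n)
          / (((3 + α) / 2 + n) * Real.Gamma ((3 + α) / 2 + n))) : ℝ) : ℂ) := by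
      intro X Y hXY hY
      apply mul_left_cancel₀ hc
      rw [eq_neg_of_add_eq_zero_left hXY, hY]
      have : -((α + 1 - 2 * n)
            * (K * (Real.Gamma ((-1 - α) / 2 + n) / Real.Gamma ((3 + α) / 2 + n))))
          = (α + 1 + 2 * n + 2) * (K * (((-1 - α) / 2 + n) * Real.Gamma ((-1 - α) / 2 + n)
          / (((3 + α) / 2 + n) * Real.Gamma ((3 + α) / 2 + n)))) := by
        generalize Real.Gamma ((-1 - α) / 2 + n) = A
        generalize Real.Gamma ((3 + α) / 2 + n) = B at hG
        have hpos' : 3 + α + 2 * n ≠ 0 := by positivity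
        field_simp
        ring
      exact_mod_cast this
    rcases hw with hw | hw
    · refine hstep _ _ ?_ (ih (2 * n) (Or.inl rfl))
      have h := integral_sin_rpow_mul_exp_recurrence (a := α + 1) (by linarith) (2 * n)
      rw [hw]
      push_cast at h ⊢
      rw [show 2 * ((n : ℂ) + 1) = 2 * n + 2 by ring]
      exact h
    · refine hstep _ _ ?_ (ih (-(2 * n)) (Or.inr rfl))
      have h := integral_sin_rpow_mul_exp_recurrence (a := α + 1) (by linarith) w
      rw [show w + 2 = -(2 * n) by rw [hw]; push_cast; ring] at h
      have hw' : w = -(2 * n) - 2 := by rw [hw]; push_cast; ring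
      linear_combination h + (- (∫ η in (0:ℝ)..π, ((Real.sin η ^ (α + 1) : ℝ) : ℂ)
        * Complex.exp (Complex.I * -(2 * n) * (η : ℂ)))
        + ∫ η in (0:ℝ)..π, ((Real.sin η ^ (α + 1) : ℝ) : ℂ)
        * Complex.exp (Complex.I * w * (η : ℂ))) * hw'

/-- Evaluation of the integral I₂ for even k (equation (33) of the paper). -/
theorem stmt_10 (α : ℝ) (hα : α ∈ Set.Ioo (0:ℝ) 1 ∪ Set.Ioo (1:ℝ) 2)
    (k : ℤ) (hk : Even k) (l : ℤ) :
    ∫ η in (0:ℝ)..π,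
        ((Real.sin η ^ α : ℝ) : ℂ)
          * (-(k : ℂ) ^ 2 * (Real.sin η : ℂ) + 2 * Complex.I * (k : ℂ) * (Real.cos η : ℂ))
          * Complex.exp (Complex.I * ((k : ℂ) - 2 * (l : ℂ)) * (η : ℂ))
      = ((π * α * (1 - α) * ((α - 1) * (k : ℝ) ^ 2 + 4 * (k : ℝ) * (l : ℝ))
            / (2 ^ (2 + α) * Real.sin (π * α / 2) * Real.Gamma (2 - α))
            * (Real.Gamma ((-1 - α) / 2 + |(k : ℝ) / 2 - (l : ℝ)|)
              / Real.Gamma ((3 + α) / 2 + |(k : ℝ) / 2 - (l : ℝ)|)) : ℝ) : ℂ) := by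
  have h0 : 0 < α := by rcases hα with h | h <;> linarith [h.1]
  have h1 : α ≠ 1 := by rcases hα with h | h <;> [exact h.2.ne; exact h.1.ne']
  have h2 : α < 2 := by rcases hα with h | h <;> linarith [h.2]
  obtain ⟨j, rfl⟩ := hk
  have habs : |((j + j : ℤ) : ℝ) / 2 - (l : ℝ)| = ((j - l).natAbs : ℝ) := by
    rw [Nat.cast_natAbs, Int.cast_abs]
    push_cast
    ring_nf
  have hw : (((j + j : ℤ) : ℂ) - 2 * (l : ℂ)) = 2 * ((j - l).natAbs : ℂ)
      ∨ (((j + j : ℤ) : ℂ) - 2 * (l : ℂ)) = -(2 * ((j - l).natAbs : ℂ)) := by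
    rcases Int.natAbs_eq (j - l) with h | h
    · left
      have h' := congrArg (Int.cast : ℤ → ℂ) h
      rw [Int.cast_natCast] at h'
      rw [← h']; push_cast; ring
    · right
      have h' := congrArg (Int.cast : ℤ → ℂ) h
      rw [Int.cast_neg, Int.cast_natCast] at h'
      rw [← neg_eq_iff_eq_neg.2 h']; push_cast; ring
  have heven := integral_sin_rpow_mul_exp_even h0 h1 h2 _ _ hw
  rw [habs]
  generalize j + j = k at *
  set w : ℂ := (k : ℂ) - 2 * (l : ℂ) with hwdef
  have hα1 : (α : ℂ) + 1 ≠ 0 := by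
    have : α + 1 ≠ 0 := by linarith
    exact_mod_cast this
  have hdecomp : ∫ η in (0:ℝ)..π,
        ((Real.sin η ^ α : ℝ) : ℂ)
          * (-(k : ℂ) ^ 2 * (Real.sin η : ℂ) + 2 * Complex.I * (k : ℂ) * (Real.cos η : ℂ))
          * Complex.exp (Complex.I * w * (η : ℂ))
      = ∫ η in (0:ℝ)..π, (2 * Complex.I * k / (α + 1) * (((Real.sin η ^ α : ℝ) : ℂ)
            * ((α + 1) * (Real.cos η : ℂ) + Complex.I * w * (Real.sin η : ℂ))
            * Complex.exp (Complex.I * w * (η : ℂ)))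
          + (-(k : ℂ) ^ 2 + 2 * k * w / (α + 1)) * (((Real.sin η ^ (α + 1) : ℝ) : ℂ)
            * Complex.exp (Complex.I * w * (η : ℂ)))) := by
    refine intervalIntegral.integral_congr fun η hη => ?_
    rw [Set.uIcc_of_le Real.pi_pos.le] at hη
    rw [Real.rpow_add_one' (Real.sin_nonneg_of_mem_Icc hη) (by linarith), Complex.ofReal_mul]
    field_simp
    ring_nf
    rw [Complex.I_sq]
    ring
  rw [hdecomp, intervalIntegral.integral_add, intervalIntegral.integral_const_mul,
    intervalIntegral.integral_const_mul, integral_sin_rpow_mul_exp_deriv h0, heven, hwdef]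
  · push_cast
    field_simp
    ring
  · apply Continuous.intervalIntegrable
    have := Real.continuous_sin.rpow_const (fun _ => Or.inr h0.le : ∀ x, Real.sin x ≠ 0 ∨ 0 ≤ α)
    fun_prop
  · exact (intervalIntegrable_sin_rpow_mul_exp (by linarith) _).const_mul _
end
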